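/- arXiv:0802.2533 — 4 statements merged into one kernel-verified Lean document; each statement's English description precedes it below -/
import Mathlib

section
/- There are exactly 161280 Latin squares of order 5, i.e., exactly 161280 functions L : Fin 5 → Fin 5 → Fin 5 such that every row map j ↦ L i j and every column map i ↦ L i j is bijective. -/
/-- A Latin square of order 5 is a function `L : Fin 5 → Fin 5 → Fin 5` such that every
row map `j ↦ L i j` and every column map `i ↦ L i j` is bijective. -/
def IsLatinSquare5 (L : Fin 5 → Fin 5 → Fin 5) : Prop :=
  (∀ i : Fin 5, Function.Bijective fun j => L i j) ∧
  (∀ j : Fin 5, Function.Bijective fun i => L i j)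

/-- The number of `k`-tuples of entries of `l` any two of which, in order, satisfy `r`. -/
def countTuples {α : Type*} (r : α → α → Bool) : ℕ → List α → ℕ
  | 0, _ => 1
  | k + 1, l => (l.map fun a => countTuples r k (l.filter (r a))).sum

theorem countTuples_map {α β : Type*} (e : α → β) (r : α → α → Bool) (s : β → β → Bool)
    (h : ∀ a b, s (e a) (e b) = r a b) (k : ℕ) (l : List α) :
    countTuples s k (l.map e) = countTuples r k l := by
  induction k generalizing l with
  | zero => rfl
  | succ k ih =>
    have hf : ∀ a, (s (e a)) ∘ e = r a := fun a => funext (h a)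
    simp only [countTuples, List.map_map, Function.comp_def, List.filter_map]
    simp only [← Function.comp_def, hf, ih]

/-- Splitting off the first entry of a tuple with pairwise related entries. -/
def tupleConsEquiv {α : Type*} (r : α → α → Bool) (k : ℕ) (l : List α) :
    {f : Fin (k + 1) → α // (∀ i, f i ∈ l) ∧ ∀ i j, i < j → r (f i) (f j)} ≃
      Σ a : {a // a ∈ l}, {g : Fin k → α //
        (∀ i, g i ∈ l.filter (r a)) ∧ ∀ i j, i < j → r (g i) (g j)} where
  toFun f := ⟨⟨f.1 0, f.2.1 0⟩, fun i => f.1 i.succ,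
    fun i => List.mem_filter.2 ⟨f.2.1 _, f.2.2 _ _ i.succ_pos⟩,
    fun i j hij => f.2.2 _ _ (Fin.succ_lt_succ_iff.2 hij)⟩
  invFun g := ⟨Fin.cons g.1.1 g.2.1, by
    obtain ⟨⟨a, ha⟩, g, hg, hr⟩ := g
    simp only [List.mem_filter] at hg
    refine ⟨Fin.cases ha fun i => (hg i).1, Fin.cases (Fin.cases ?_ fun j _ => (hg j).2)
      fun i => Fin.cases ?_ fun j hij => hr i j (Fin.succ_lt_succ_iff.1 hij)⟩
    · intro h
      exact absurd h (lt_irrefl _)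
    · intro h
      exact absurd h (Fin.not_lt_zero _)⟩
  left_inv f := Subtype.ext (Fin.cons_self_tail f.1)
  right_inv _ := rfl

theorem card_tuples {α : Type*} [Finite α] (r : α → α → Bool) (k : ℕ) (l : List α)
    (hl : l.Nodup) :
    Nat.card {f : Fin k → α // (∀ i, f i ∈ l) ∧ ∀ i j, i < j → r (f i) (f j)} =
      countTuples r k l := by
  classical
  induction k generalizing l with
  | zero =>
    rw [Nat.card_eq_one_iff_unique.2, countTuples]
    exact ⟨⟨fun f g => Subtype.ext (Subsingleton.elim _ _)⟩,
      ⟨⟨Fin.elim0, fun i => i.elim0, fun i => i.elim0⟩⟩⟩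
  | succ k ih =>
    have : Fintype {a // a ∈ l} := List.Subtype.fintype l
    rw [Nat.card_congr (tupleConsEquiv r k l), Nat.card_sigma, countTuples,
      ← List.sum_toFinset _ hl]
    simp only [ih _ (hl.filter _)]
    exact (Finset.sum_subtype l.toFinset (fun _ => List.mem_toFinset)
      fun a => countTuples r k (l.filter (r a))).symm

/-- Two permutations that agree nowhere. -/
def disagree {n : ℕ} (σ τ : Equiv.Perm (Fin n)) : Bool := decide (∀ c, σ c ≠ τ c)

/-- Left multiplication normalises the first of a sequence of pairwise disagreeing permutations
to the identity. -/
def normalizeFirstEquiv (n k : ℕ) :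
    {f : Fin (k + 1) → Equiv.Perm (Fin n) // ∀ i j, i < j → disagree (f i) (f j)} ≃
      Equiv.Perm (Fin n) × {g : Fin k → Equiv.Perm (Fin n) //
        (∀ i, disagree 1 (g i)) ∧ ∀ i j, i < j → disagree (g i) (g j)} where
  toFun f := (f.1 0, ⟨fun i => (f.1 0)⁻¹ * f.1 i.succ, by
    obtain ⟨f, hf⟩ := f
    simp only [disagree, decide_eq_true_eq] at hf ⊢
    refine ⟨fun i c h => hf 0 i.succ i.succ_pos c ?_, fun i j hij c h =>
      hf i.succ j.succ (Fin.succ_lt_succ_iff.2 hij) c ((f 0)⁻¹.injective h)⟩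
    simpa using congrArg (f 0) h⟩)
  invFun g := ⟨Fin.cons g.1 fun i => g.1 * g.2.1 i, by
    obtain ⟨σ, g, h1, hg⟩ := g
    simp only [disagree, decide_eq_true_eq] at h1 hg ⊢
    refine Fin.cases (Fin.cases ?_ fun j _ c h => h1 j c (σ.injective h))
      fun i => Fin.cases ?_ fun j hij c h =>
        hg i j (Fin.succ_lt_succ_iff.1 hij) c (σ.injective h)
    · intro h
      exact absurd h (lt_irrefl _)
    · intro h
      exact absurd h (Fin.not_lt_zero _)⟩
  left_inv f := by
    refine Subtype.ext (funext (Fin.cases rfl fun i => ?_))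
    simp
  right_inv g := by
    refine Prod.ext rfl (Subtype.ext (funext fun i => ?_))
    simp

/-- A Latin square is a sequence of pairwise disagreeing permutations, its rows. -/
noncomputable def latinSquareRowsEquiv :
    {L : Fin 5 → Fin 5 → Fin 5 // IsLatinSquare5 L} ≃
      {f : Fin 5 → Equiv.Perm (Fin 5) // ∀ i j, i < j → disagree (f i) (f j)} where
  toFun L := ⟨fun i => Equiv.ofBijective _ (L.2.1 i), fun i j hij =>
    decide_eq_true fun c h => hij.ne ((L.2.2 c).injective h)⟩
  invFun f := ⟨fun i j => f.1 i j, fun i => (f.1 i).bijective, fun c =>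
    Finite.injective_iff_bijective.1 fun i j h => by
      by_contra hij
      rcases lt_or_gt_of_ne hij with hlt | hlt
      · exact of_decide_eq_true (f.2 _ _ hlt) c h
      · exact of_decide_eq_true (f.2 _ _ hlt) c h.symm⟩
  left_inv _ := rfl
  right_inv f := Subtype.ext (funext fun i => Equiv.ext fun _ => rfl)

/-- The list of derangements of `Fin 5`. -/
def derangementsFive : List (Equiv.Perm (Fin 5)) :=
  (permsOfList (List.finRange 5)).filter (disagree 1)

theorem nodup_derangementsFive : derangementsFive.Nodup :=
  (nodup_permsOfList (List.nodup_finRange 5)).filter _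

theorem mem_derangementsFive (σ : Equiv.Perm (Fin 5)) :
    σ ∈ derangementsFive ↔ disagree 1 σ := by
  simp [derangementsFive, mem_permsOfList_iff]

/-- The values of a permutation of `Fin 5`. -/
def permValues (σ : Equiv.Perm (Fin 5)) : ℕ × ℕ × ℕ × ℕ × ℕ :=
  (σ 0, σ 1, σ 2, σ 3, σ 4)

/-- Two 5-tuples that differ in every coordinate. -/
def differ : ℕ × ℕ × ℕ × ℕ × ℕ → ℕ × ℕ × ℕ × ℕ × ℕ → Bool
  | (a₁, b₁, c₁, d₁, e₁), (a₂, b₂, c₂, d₂, e₂) =>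
    !Nat.beq a₁ a₂ && (!Nat.beq b₁ b₂ && (!Nat.beq c₁ c₂ && (!Nat.beq d₁ d₂ && !Nat.beq e₁ e₂)))

theorem differ_permValues (σ τ : Equiv.Perm (Fin 5)) :
    differ (permValues σ) (permValues τ) = disagree σ τ := by
  rw [Bool.eq_iff_iff]
  have beq_eq_decide (m n : ℕ) : Nat.beq m n = decide (m = n) := by
    rw [Bool.eq_iff_iff, Nat.beq_eq, decide_eq_true_eq]
  simp [differ, permValues, disagree, Fin.forall_fin_succ, Fin.ext_iff, beq_eq_decide]

theorem map_permValues_derangementsFive :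
    derangementsFive.map permValues =
   [(1, 0, 3, 4, 2), (1, 0, 4, 2, 3), (1, 2, 0, 4, 3), (1, 2, 3, 4, 0), (1, 2, 4, 0, 3),
    (1, 3, 0, 4, 2), (1, 3, 4, 0, 2), (1, 3, 4, 2, 0), (1, 4, 3, 2, 0), (1, 4, 3, 0, 2),
    (1, 4, 0, 2, 3), (2, 0, 1, 4, 3), (2, 0, 3, 4, 1), (2, 0, 4, 1, 3), (2, 3, 0, 4, 1),
    (2, 3, 1, 4, 0), (2, 3, 4, 1, 0), (2, 3, 4, 0, 1), (2, 4, 0, 1, 3), (2, 4, 3, 0, 1),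
    (2, 4, 3, 1, 0), (2, 4, 1, 0, 3), (3, 2, 1, 4, 0), (3, 2, 0, 4, 1), (3, 2, 4, 0, 1),
    (3, 2, 4, 1, 0), (3, 0, 1, 4, 2), (3, 0, 4, 1, 2), (3, 0, 4, 2, 1), (3, 4, 0, 2, 1),
    (3, 4, 0, 1, 2), (3, 4, 1, 0, 2), (3, 4, 1, 2, 0), (4, 2, 1, 0, 3), (4, 2, 3, 1, 0),
    (4, 2, 3, 0, 1), (4, 2, 0, 1, 3), (4, 3, 1, 2, 0), (4, 3, 1, 0, 2), (4, 3, 0, 1, 2),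
    (4, 3, 0, 2, 1), (4, 0, 3, 2, 1), (4, 0, 3, 1, 2), (4, 0, 1, 2, 3)] := by
  decide +kernel

theorem countTuples_derangementsFive : countTuples disagree 4 derangementsFive = 1344 := by
  rw [← countTuples_map permValues disagree differ differ_permValues,
    map_permValues_derangementsFive]
  decide +kernel

/-- There are exactly 161280 Latin squares of order 5. -/
theorem card_latin_squares_order_five :
    Nat.card {L : Fin 5 → Fin 5 → Fin 5 // IsLatinSquare5 L} = 161280 := by
  rw [Nat.card_congr (latinSquareRowsEquiv.trans (normalizeFirstEquiv 5 4)), Nat.card_prod]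
  simp only [← mem_derangementsFive]
  rw [card_tuples disagree 4 _ nodup_derangementsFive, countTuples_derangementsFive,
    Nat.card_perm, Nat.card_fin]
  norm_num [Nat.factorial]
end

section
/- There are exactly 1344 Latin squares of order 5 whose first row is the identity, i.e., exactly 1344 Latin squares L with L 0 j = j for all j. (This is the paper's count of 5-by-5 Latin squares up to renaming of symbols, and hence the number of 4-simplices of the space B²(Σ⁶) of colorings of B(Σ⁶).) -/
/-- The `n`-tuples with entries in `l` whose entries are pairwise related by `r`, found by
backtracking. -/
def pairwiseTuples {α : Type*} (r : α → α → Bool) : (n : ℕ) → List α → List (Fin n → α)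
  | 0, _ => [Fin.elim0]
  | n + 1, l => l.flatMap fun a => (pairwiseTuples r n (l.filter (r a))).map (Fin.cons a)

theorem mem_pairwiseTuples {α : Type*} {r : α → α → Bool} {n : ℕ} {l : List α} {f : Fin n → α} :
    f ∈ pairwiseTuples r n l ↔ (∀ i, f i ∈ l) ∧ ∀ i j, i < j → r (f i) (f j) := by
  induction n generalizing l with
  | zero => simpa [pairwiseTuples] using Subsingleton.elim _ _
  | succ n ih =>
    induction f using Fin.consCases with
    | cons a f =>
      simp only [pairwiseTuples, List.mem_flatMap, List.mem_map, Fin.cons_inj, ih,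
        List.mem_filter, Fin.forall_fin_succ (n := n), Fin.cons_zero, Fin.cons_succ,
        Fin.succ_lt_succ_iff, Fin.succ_pos, Fin.not_lt_zero]
      constructor
      · rintro ⟨a, ha, f, hf, rfl, rfl⟩
        grind
      · exact fun h => ⟨a, by grind, f, by grind, rfl, rfl⟩

theorem nodup_pairwiseTuples {α : Type*} (r : α → α → Bool) (n : ℕ) {l : List α}
    (hl : l.Nodup) : (pairwiseTuples r n l).Nodup := by
  induction n generalizing l with
  | zero => simp [pairwiseTuples]
  | succ n ih =>
    refine List.nodup_flatMap.2 ⟨fun a _ => (ih (hl.filter _)).map (Fin.cons_right_injective (α := fun _ => α) a),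
      hl.imp fun hab f hfa hfb => ?_⟩
    obtain ⟨g, -, rfl⟩ := List.mem_map.1 hfa
    obtain ⟨h, -, hh⟩ := List.mem_map.1 hfb
    exact hab (Fin.cons_inj.1 hh).1.symm

/-- Whether two rows of length 5 differ in every column. -/
def rowsDisjoint (f g : Fin 5 → Fin 5) : Bool :=
  f 0 != g 0 && f 1 != g 1 && f 2 != g 2 && f 3 != g 3 && f 4 != g 4

theorem rowsDisjoint_iff {f g : Fin 5 → Fin 5} : rowsDisjoint f g ↔ ∀ j, f j ≠ g j := by
  simp [rowsDisjoint, Fin.forall_fin_succ, and_assoc]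

/-- The injective rows of length 5 without fixed points. -/
def derangedRows : List (Fin 5 → Fin 5) :=
  (pairwiseTuples (· != ·) 5 (List.finRange 5)).filter (rowsDisjoint id)

theorem nodup_derangedRows : derangedRows.Nodup :=
  (nodup_pairwiseTuples _ _ (List.nodup_finRange 5)).filter _

theorem forall_lt_ne_iff_injective {n : ℕ} {β : Type*} {f : Fin n → β} :
    (∀ i j, i < j → f i ≠ f j) ↔ Function.Injective f := by
  refine ⟨fun h i j hij => ?_, fun h i j hij => h.ne hij.ne⟩
  rcases lt_trichotomy i j with hlt | heq | hlt
  · exact (h i j hlt hij).elim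
  · exact heq
  · exact (h j i hlt hij.symm).elim

theorem mem_derangedRows {f : Fin 5 → Fin 5} :
    f ∈ derangedRows ↔ Function.Injective f ∧ ∀ j, j ≠ f j := by
  simp [derangedRows, mem_pairwiseTuples, rowsDisjoint_iff, ← forall_lt_ne_iff_injective]

/-- The Latin squares of order 5 whose first row is the identity. -/
def latinSquaresFirstRowId : List (Fin 5 → Fin 5 → Fin 5) :=
  (pairwiseTuples rowsDisjoint 4 derangedRows).map (Fin.cons id)

theorem nodup_latinSquaresFirstRowId : latinSquaresFirstRowId.Nodup :=
  (nodup_pairwiseTuples _ _ nodup_derangedRows).map (Fin.cons_right_injective (α := fun _ => Fin 5 → Fin 5) id)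

theorem mem_latinSquaresFirstRowId {L : Fin 5 → Fin 5 → Fin 5} :
    L ∈ latinSquaresFirstRowId ↔ IsLatinSquare5 L ∧ ∀ j, L 0 j = j := by
  simp only [latinSquaresFirstRowId, List.mem_map, mem_pairwiseTuples, mem_derangedRows,
    rowsDisjoint_iff, IsLatinSquare5, ← Finite.injective_iff_bijective]
  constructor
  · rintro ⟨g, ⟨hg, hgg⟩, rfl⟩
    refine ⟨⟨Fin.cases Function.injective_id fun i => (hg i).1, fun j => ?_⟩, fun j => rfl⟩
    refine forall_lt_ne_iff_injective.1 fun i i' => ?_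
    cases i using Fin.cases <;> cases i' using Fin.cases
    · simp
    · exact fun _ => (hg _).2 j
    · simp
    · exact fun h => hgg _ _ (Fin.succ_lt_succ_iff.1 h) j
  · rintro ⟨⟨hrow, hcol⟩, hid⟩
    refine ⟨Fin.tail L, ⟨fun i => ⟨hrow i.succ, fun j h => ?_⟩, fun i i' h j hij => ?_⟩, ?_⟩
    · exact (Fin.succ_ne_zero i).symm (hcol j ((hid j).trans h))
    · exact h.ne (Fin.succ_injective _ (hcol j hij))
    · rw [← Fin.cons_self_tail L]
      exact congrArg₂ _ (funext fun j => (hid j).symm) rfl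

theorem length_latinSquaresFirstRowId : latinSquaresFirstRowId.length = 1344 := by
  decide +kernel

/-- There are exactly 1344 Latin squares of order 5 whose first row is the identity. -/
theorem card_latin_squares_order_five_first_row_id :
    Nat.card {L : Fin 5 → Fin 5 → Fin 5 // IsLatinSquare5 L ∧ ∀ j : Fin 5, L 0 j = j}
      = 1344 := by
  rw [← length_latinSquaresFirstRowId, ← List.toFinset_card_of_nodup nodup_latinSquaresFirstRowId]
  exact Nat.subtype_card _ fun L => by rw [List.mem_toFinset, mem_latinSquaresFirstRowId]
end

section
/- Let L be a Latin square of order 5 in which every row permutation j ↦ L i j and every column permutation i ↦ L i j is even. Then for every symbol k : Fin 5, the permutation σ_k of Fin 5 defined by σ_k i = the unique j with L i j = k is also an even permutation. (This is the paper's statement that the vertices of the two complexes formed by the 144 even Latin squares are all even permutations of {1,2,3,4,5}.) -/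
open Equiv

set_option synthInstance.maxSize 10000 in
/-- In a reduced Latin square of order 5 with even rows `1, a, b, c, d`, the permutation `s` of
each symbol is even. -/
theorem sign_symbol_of_reduced :
    ∀ a : Perm (Fin 5), a 0 = 1 → (∀ x, a x ≠ x) → Perm.sign a = 1 →
    ∀ b : Perm (Fin 5), b 0 = 2 → (∀ x, b x ≠ x) → (∀ x, b x ≠ a x) → Perm.sign b = 1 →
    ∀ c : Perm (Fin 5), c 0 = 3 → (∀ x, c x ≠ x) → (∀ x, c x ≠ a x) → (∀ x, c x ≠ b x) →
      Perm.sign c = 1 →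
    ∀ d : Perm (Fin 5), d 0 = 4 → (∀ x, d x ≠ x) → (∀ x, d x ≠ a x) → (∀ x, d x ≠ b x) →
      (∀ x, d x ≠ c x) → Perm.sign d = 1 →
    ∀ s : Perm (Fin 5), a (s 1) = s 0 → b (s 2) = s 0 → c (s 3) = s 0 → d (s 4) = s 0 →
      Perm.sign s = 1 := by
  decide +kernel

/-- If `L` is a Latin square of order 5 all of whose row permutations `j ↦ L i j` and column
permutations `i ↦ L i j` are even, then for every symbol `k`, the permutation `σ_k` sending
each `i` to the unique `j` with `L i j = k` is also even. -/
theorem symbol_perm_even (L : Fin 5 → Fin 5 → Fin 5)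
    (hrow : ∀ i : Fin 5, ∃ σ : Equiv.Perm (Fin 5),
      (∀ j : Fin 5, L i j = σ j) ∧ Equiv.Perm.sign σ = 1)
    (hcol : ∀ j : Fin 5, ∃ σ : Equiv.Perm (Fin 5),
      (∀ i : Fin 5, L i j = σ i) ∧ Equiv.Perm.sign σ = 1)
    (k : Fin 5) (σk : Equiv.Perm (Fin 5)) (hσk : ∀ i : Fin 5, L i (σk i) = k) :
    Equiv.Perm.sign σk = 1 := by
  choose r hr hrs using hrow
  choose c hc hcs using hcol
  have hrc : ∀ i j, r i j = c j i := fun i j => (hr i j).symm.trans (hc j i)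
  -- Relabelling the symbols by `(r 0)⁻¹` and the rows by `g` makes the square reduced.
  set g : Perm (Fin 5) := (c 0)⁻¹ * r 0 with hg
  have hg0 : g 0 = 0 := by simp [hg, hrc]
  have hgs : Perm.sign g = 1 := by simp [hg, hrs, hcs]
  let a : Fin 5 → Perm (Fin 5) := fun i => (r 0)⁻¹ * r (g i)
  have ha0 : ∀ x, a 0 x = x := by simp [a, hg0]
  have hcol0 : ∀ i, a i 0 = i := by simp [a, hrc _ 0, hg]
  have hsign : ∀ i, Perm.sign (a i) = 1 := by simp [a, hrs]
  have hne : ∀ i j, i ≠ j → ∀ x, a i x ≠ a j x := by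
    intro i j hij x h
    simp only [a, Perm.mul_apply, EmbeddingLike.apply_eq_iff_eq, hrc _ x] at h
    exact hij h
  have hne0 : ∀ i, i ≠ 0 → ∀ x, a i x ≠ x := fun i hi x => by
    simpa [ha0] using hne i 0 hi x
  have hsym : ∀ i, a i ((σk * g) i) = (σk * g) 0 := by
    intro i
    have h : ∀ i, r i (σk i) = k := fun i => (hr i _).symm.trans (hσk i)
    rw [← ha0 ((σk * g) 0)]
    simp only [a, Perm.mul_apply, h]
  have key := sign_symbol_of_reduced
    (a 1) (hcol0 1) (hne0 1 (by decide)) (hsign 1)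
    (a 2) (hcol0 2) (hne0 2 (by decide)) (hne 2 1 (by decide)) (hsign 2)
    (a 3) (hcol0 3) (hne0 3 (by decide)) (hne 3 1 (by decide)) (hne 3 2 (by decide)) (hsign 3)
    (a 4) (hcol0 4) (hne0 4 (by decide)) (hne 4 1 (by decide)) (hne 4 2 (by decide))
      (hne 4 3 (by decide)) (hsign 4)
    (σk * g) (hsym 1) (hsym 2) (hsym 3) (hsym 4)
  simpa [hgs] using key
end

section
/- The 600-cell graph Σ has exactly 1200 proper colorings with 5 colors, i.e., there are exactly 1200 functions f : V → Fin 5 with f q ≠ f q' whenever q and q' are adjacent in Σ. (Equivalently, since the 120 relabelings of colors act freely, the 600-cell has exactly 10 five-colorings, the main counting result of the paper.) -/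
/-- The golden ratio. -/
noncomputable def gr : ℝ := (1 + Real.sqrt 5) / 2

/-- The coefficient 4-tuple of a quaternion with respect to the basis (1, i, j, k). -/
def coords (q : Quaternion ℝ) : Fin 4 → ℝ := ![q.re, q.imI, q.imJ, q.imK]

/-- `x` is a sign, i.e. `x = ±1`. -/
def IsSign (x : ℝ) : Prop := x = 1 ∨ x = -1

/-- The 120 vertices of the regular 600-cell of circumradius 1: the eight unit quaternions
`±1, ±i, ±j, ±k`, the sixteen quaternions `½(±1 ± i ± j ± k)`, and the ninety-six quaternions
whose coefficient 4-tuple is an even permutation of `(±φ/2, ±1/2, ±1/(2φ), 0)`. -/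
noncomputable def V600 : Set (Quaternion ℝ) :=
  {q | (∃ ε : ℝ, IsSign ε ∧
          (coords q = ![ε, 0, 0, 0] ∨ coords q = ![0, ε, 0, 0] ∨
           coords q = ![0, 0, ε, 0] ∨ coords q = ![0, 0, 0, ε])) ∨
       (∃ ε₀ ε₁ ε₂ ε₃ : ℝ, IsSign ε₀ ∧ IsSign ε₁ ∧ IsSign ε₂ ∧ IsSign ε₃ ∧
          coords q = ![ε₀ / 2, ε₁ / 2, ε₂ / 2, ε₃ / 2]) ∨
       (∃ ε₁ ε₂ ε₃ : ℝ, IsSign ε₁ ∧ IsSign ε₂ ∧ IsSign ε₃ ∧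
          ∃ σ : Equiv.Perm (Fin 4), Equiv.Perm.sign σ = 1 ∧
            coords q = ![ε₁ * gr / 2, ε₂ / 2, ε₃ / (2 * gr), 0] ∘ σ)}

/-- The 600-cell graph: distinct vertices are adjacent iff their distance is `φ - 1`. -/
noncomputable def sigma600 : SimpleGraph V600 :=
  SimpleGraph.fromRel fun q q' => ‖(q : Quaternion ℝ) - (q' : Quaternion ℝ)‖ = gr - 1

namespace SixHundredCell

/-! ### Enumeration of list colorings -/

section ListColoring

variable {α C : Type*} [DecidableEq C]

/-- Remove from a list of colors those colors occurring in a second list at the positions marked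
`true` by a list of Booleans. -/
def freeColors : List Bool → List C → List C → List C
  | true :: r, c :: cs, p => freeColors r cs (p.filter (· ≠ c))
  | false :: r, _ :: cs, p => freeColors r cs p
  | _, _, p => p

theorem mem_freeColors {g : α → Bool} {f : α → C} {l : List α} {p : List C} {c : C} :
    c ∈ freeColors (l.map g) (l.map f) p ↔ c ∈ p ∧ ∀ b ∈ l, g b = true → c ≠ f b := by
  induction l generalizing p with
  | nil => simp [freeColors]
  | cons b l ih => cases hb : g b <;> simp [freeColors, hb, ih, and_assoc]

variable (G : SimpleGraph α) [DecidableRel G.Adj] (palette : α → List C)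

/-- The color sequences along a list of vertices arising from the proper colorings of these vertices
that take each color from the palette of its vertex. -/
def listColorings : List α → List (List C)
  | [] => [[]]
  | a :: l => (listColorings l).flatMap fun cs =>
      (freeColors (l.map fun b => decide (G.Adj a b)) cs (palette a)).map (· :: cs)

variable {G palette}

theorem mem_listColorings [DecidableEq α] [Inhabited C] {l : List α} (hl : l.Nodup) {cs : List C} :
    cs ∈ listColorings G palette l ↔ ∃ f : α → C, (∀ a ∈ l, f a ∈ palette a) ∧
      l.Pairwise (fun a b => G.Adj a b → f a ≠ f b) ∧ l.map f = cs := by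
  induction l generalizing cs with
  | nil => simp [listColorings, eq_comm]
  | cons a l ih =>
    obtain ⟨ha, hl⟩ := List.nodup_cons.1 hl
    simp only [listColorings, List.mem_flatMap, List.mem_map, ih hl]
    constructor
    · rintro ⟨_, ⟨f, hf, hp, rfl⟩, c, hc, rfl⟩
      rw [mem_freeColors] at hc
      have hu : ∀ b ∈ l, Function.update f a c b = f b := fun b hb =>
        Function.update_of_ne (ne_of_mem_of_not_mem hb ha) _ _
      refine ⟨Function.update f a c, ?_, ?_, ?_⟩
      · simpa [hc.1] using fun b hb => (hu b hb).symm ▸ hf b hb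
      · refine List.pairwise_cons.2 ⟨fun b hb hab => ?_, hp.imp_of_mem fun hb hd h => ?_⟩
        · simpa [hu b hb] using hc.2 b hb (by simpa using hab)
        · simpa [hu _ hb, hu _ hd] using h
      · simpa using hu
    · rintro ⟨f, hf, hp, rfl⟩
      obtain ⟨hpa, hp⟩ := List.pairwise_cons.1 hp
      refine ⟨l.map f, ⟨f, fun b hb => hf b (List.mem_cons_of_mem _ hb), hp, rfl⟩, f a, ?_, rfl⟩
      exact mem_freeColors.2 ⟨hf a List.mem_cons_self, fun b hb h => hpa b hb (by simpa using h)⟩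

theorem card_listColorings [DecidableEq α] [Inhabited C] {l : List α} (hl : l.Nodup)
    (hmem : ∀ a, a ∈ l) :
    Nat.card {f : α → C // (∀ a, f a ∈ palette a) ∧ ∀ a b, G.Adj a b → f a ≠ f b} =
      (listColorings G palette l).toFinset.card := by
  have hinj : Function.Injective fun f : α → C => l.map f := fun f g h =>
    funext fun a => List.map_inj_left.1 h a (hmem a)
  rw [← Set.ncard_coe_finset, ← Set.coe_ofPred, Nat.card_coe_set_eq,
    ← Set.ncard_image_of_injective _ hinj]
  congr 1
  ext cs
  have hp (f : α → C) : l.Pairwise (fun a b => G.Adj a b → f a ≠ f b) ↔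
      ∀ a b, G.Adj a b → f a ≠ f b :=
    ⟨fun h a b hab => haveI : Std.Symm fun a b => G.Adj a b → f a ≠ f b :=
        ⟨fun _ _ h hab => (h hab.symm).symm⟩
      h.forall (hmem a) (hmem b) hab.ne hab, fun h => List.pairwise_of_forall h⟩
  simp [mem_listColorings hl, hmem, hp, and_assoc]

end ListColoring

/-! ### Normalizing a coloring on a clique -/

/-- A graph containing an `n`-clique has `(n + 1)!` times as many proper colorings with `n + 1`
colors as it has such colorings that are prescribed on the clique. -/
theorem card_colorings_eq_factorial_mul {α : Type*} (G : SimpleGraph α) {n : ℕ} (v : Fin n → α)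
    (hv : ∀ i j, i ≠ j → G.Adj (v i) (v j)) :
    Nat.card {f : α → Fin (n + 1) // ∀ a b, G.Adj a b → f a ≠ f b} = (n + 1).factorial *
      Nat.card {f : α → Fin (n + 1) // (∀ i, f (v i) = i.castSucc) ∧
        ∀ a b, G.Adj a b → f a ≠ f b} := by
  have hperm : Nat.card (Equiv.Perm (Fin (n + 1))) = (n + 1).factorial := by
    rw [Nat.card_perm, Nat.card_fin]
  rw [← hperm, ← Nat.card_prod]
  symm
  refine Nat.card_congr (Equiv.ofBijective (fun p => ⟨fun a => p.1 (p.2.1 a), fun a b h =>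
    p.1.injective.ne (p.2.2.2 a b h)⟩) ⟨?_, ?_⟩)
  · rintro ⟨σ, f, hf, _⟩ ⟨τ, g, hg, _⟩ h
    replace h : ∀ a, σ (f a) = τ (g a) := congrFun (congrArg Subtype.val h)
    have hστ : ∀ i : Fin n, (τ⁻¹ * σ) i.castSucc = i.castSucc := fun i => by
      have := h (v i)
      rw [hf, hg] at this
      simp [this]
    have hlast : (τ⁻¹ * σ) (Fin.last n) = Fin.last n := by
      by_contra hne
      obtain ⟨i, hi⟩ := Fin.exists_castSucc_eq.2 hne
      exact Fin.castSucc_ne_last i ((τ⁻¹ * σ).injective ((hστ i).trans hi))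
    have heq : σ = τ := by
      rw [← inv_mul_eq_one, ← inv_inj, mul_inv_rev, inv_inv, inv_one]
      ext k
      induction k using Fin.lastCases with
      | last => simp [hlast]
      | cast i => simp [hστ]
    subst heq
    have : f = g := funext fun a => σ.injective (h a)
    subst this
    rfl
  · rintro ⟨f, hf⟩
    have hinj : Function.Injective (f ∘ v) := fun i j hij => by
      by_contra hne
      exact hf _ _ (hv i j hne) hij
    let σ := ((Equiv.ofInjective _ (Fin.castSucc_injective n)).symm.trans
      (Equiv.ofInjective _ hinj)).extendSubtype
    have hσ : ∀ i, σ i.castSucc = f (v i) := fun i => by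
      rw [Equiv.extendSubtype_apply_of_mem _ _ ⟨i, rfl⟩, Equiv.trans_apply,
        Equiv.ofInjective_symm_apply (Fin.castSucc_injective n), Equiv.ofInjective_apply]
      rfl
    refine ⟨⟨σ, fun a => σ.symm (f a), fun i => ?_, fun a b h => σ.symm.injective.ne (hf a b h)⟩,
      Subtype.ext (funext fun a => σ.apply_symm_apply _)⟩
    simp only [← hσ, σ.symm_apply_apply]

/-! ### The golden integers -/

/-- The ring `ℤ[φ]` of golden integers. -/
abbrev GoldenInt := QuadraticAlgebra ℤ 1 1

theorem gr_eq_goldenRatio : gr = Real.goldenRatio := rfl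

theorem gr_sq : gr ^ 2 = gr + 1 := Real.goldenRatio_sq

/-- The embedding `ℤ[φ] → ℝ`. -/
noncomputable def GoldenInt.toReal : GoldenInt →ₐ[ℤ] ℝ :=
  QuadraticAlgebra.lift ⟨gr, by linear_combination gr_sq⟩

theorem GoldenInt.toReal_apply (x : GoldenInt) : x.toReal = x.re + x.im * gr := by
  simp [GoldenInt.toReal]

theorem GoldenInt.toReal_injective : Function.Injective GoldenInt.toReal := by
  rw [injective_iff_map_eq_zero]
  intro x hx
  rw [GoldenInt.toReal_apply] at hx
  have him : x.im = 0 := by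
    by_contra h
    have := (Real.goldenRatio_irrational.intCast_mul h).intCast_add x.re
    exact this.ne_zero (gr_eq_goldenRatio ▸ hx)
  ext
  · simpa [him] using hx
  · exact him

/-! ### A model of the 600-cell graph -/

/-- The doubled coordinates of the vertices of the 600-cell, indexed by the digits `0` to `8`. -/
def coordOfDigit : ℕ → GoldenInt
  | 1 => ⟨1, 0⟩ | 2 => ⟨-1, 0⟩ | 3 => ⟨0, 1⟩ | 4 => ⟨0, -1⟩
  | 5 => ⟨-1, 1⟩ | 6 => ⟨1, -1⟩ | 7 => ⟨2, 0⟩ | 8 => ⟨-2, 0⟩ | _ => ⟨0, 0⟩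

/-- The vertices of the 600-cell, each given by the four digits of its doubled coordinates. The
first four vertices form a clique, and the order keeps the number of partial colorings small. -/
def vertexCodes : List ℕ := [
  1111, 5310, 0351, 1305, 0700, 0135, 6310, 5103, 0513, 2111, 6103, 2305, 0361, 0352, 0136,
  2306, 2530, 2112, 4150, 1306, 0362, 5320, 6320, 6104, 4502, 2122, 4160, 2121, 4501, 1112,
  1530, 3150, 5104, 0514, 0146, 1122, 0524, 0145, 2540, 3160, 3502, 1121, 1540, 0523, 3501,
  6042, 5042, 0080, 3026, 1064, 3025, 7000, 5041, 1063, 1640, 6041, 0007, 1053, 3015, 5031,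
  3016, 3601, 2063, 2053, 0623, 4025, 1221, 3260, 5203, 0245, 6031, 0613, 0070, 6203, 1211,
  4015, 3250, 1630, 5032, 1054, 3602, 1212, 1222, 1405, 6032, 0235, 0008, 2211, 2630, 4601,
  8000, 4016, 0451, 4026, 2640, 2221, 0461, 5410, 0236, 0246, 5420, 1406, 5204, 0624, 0614,
  2064, 2054, 0800, 6410, 2405, 6420, 0452, 0462, 2222, 6204, 4260, 2406, 2212, 4602, 4250]

/-- The doubled coordinates of the `i`-th vertex. -/
def vertex (i : Fin 120) : Fin 4 → GoldenInt :=
  let n := vertexCodes.getD i 0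
  ![coordOfDigit (n / 1000), coordOfDigit (n / 100 % 10), coordOfDigit (n / 10 % 10),
    coordOfDigit (n % 10)]

/-- The squared Euclidean distance. -/
def sqDist (u v : Fin 4 → GoldenInt) : GoldenInt :=
  (u 0 - v 0) * (u 0 - v 0) + (u 1 - v 1) * (u 1 - v 1) +
    (u 2 - v 2) * (u 2 - v 2) + (u 3 - v 3) * (u 3 - v 3)

/-- The 600-cell graph on the indices of the vertices; note that `4 (φ - 1)² = 8 - 4 φ`. -/
def modelGraph : SimpleGraph (Fin 120) where
  Adj i j := sqDist (vertex i) (vertex j) = ⟨8, -4⟩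
  symm := ⟨fun i j h => by rw [← h]; simp only [sqDist]; ring⟩
  loopless := ⟨fun i h => by simp [sqDist, QuadraticAlgebra.ext_iff] at h⟩

instance : DecidableRel modelGraph.Adj := fun i j =>
  inferInstanceAs (Decidable (sqDist (vertex i) (vertex j) = ⟨8, -4⟩))

/-- The quaternion with given doubled coordinates. -/
noncomputable def toQuaternion (v : Fin 4 → GoldenInt) : Quaternion ℝ :=
  ⟨(v 0).toReal / 2, (v 1).toReal / 2, (v 2).toReal / 2, (v 3).toReal / 2⟩

theorem coords_injective : Function.Injective coords := fun p q h => by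
  have h (c : Fin 4) : coords p c = coords q c := congrFun h c
  ext
  exacts [h 0, h 1, h 2, h 3]

theorem coords_toQuaternion (v : Fin 4 → GoldenInt) :
    coords (toQuaternion v) = fun c => (v c).toReal / 2 := by
  ext c
  fin_cases c <;> rfl

theorem toQuaternion_injective : Function.Injective toQuaternion := fun u v h => by
  replace h := congrArg coords h
  simp only [coords_toQuaternion] at h
  ext1 c
  exact GoldenInt.toReal_injective (by simpa using congrFun h c)

theorem norm_toQuaternion_sub_eq_iff (u v : Fin 4 → GoldenInt) :
    ‖toQuaternion u - toQuaternion v‖ = gr - 1 ↔ sqDist u v = ⟨8, -4⟩ := by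
  have hgr : 0 ≤ gr - 1 := sub_nonneg.2 Real.one_lt_goldenRatio.le
  have hnorm : 4 * ‖toQuaternion u - toQuaternion v‖ ^ 2 = (sqDist u v).toReal := by
    rw [sq, ← Quaternion.normSq_eq_norm_mul_self, Quaternion.normSq_def', Quaternion.re_sub,
      Quaternion.imI_sub, Quaternion.imJ_sub, Quaternion.imK_sub]
    simp only [sqDist, toQuaternion, map_add, map_mul, map_sub]
    ring
  rw [← sq_eq_sq₀ (norm_nonneg _) hgr, ← GoldenInt.toReal_injective.eq_iff, ← hnorm,
    GoldenInt.toReal_apply]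
  push_cast
  constructor <;> intro h
  · linear_combination 4 * h + 4 * gr_sq
  · linear_combination h / 4 - gr_sq

/-- The doubled coordinate tuples of the vertices of the 600-cell. -/
def IsModelVertex (v : Fin 4 → GoldenInt) : Prop :=
  (∃ (u : ℤˣ) (c : Fin 4), v = Pi.single c ⟨2 * u, 0⟩) ∨
  (∃ u : Fin 4 → ℤˣ, v = fun c => ⟨u c, 0⟩) ∨
  ∃ σ : Equiv.Perm (Fin 4), σ.sign = 1 ∧ ∃ u₁ u₂ u₃ : ℤˣ,
    v = ![⟨0, u₁⟩, ⟨u₂, 0⟩, ⟨-u₃, u₃⟩, 0] ∘ σ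

set_option maxRecDepth 10000 in
theorem vertex_injective : Function.Injective vertex := by
  decide +kernel

theorem isModelVertex_vertex : ∀ i, IsModelVertex (vertex i) := by
  unfold IsModelVertex
  decide +kernel

theorem IsModelVertex.exists_vertex_eq {v : Fin 4 → GoldenInt} (hv : IsModelVertex v) :
    ∃ i, vertex i = v := by
  have h₁ : ∀ (u : ℤˣ) (c : Fin 4), ∃ i, vertex i = Pi.single c ⟨2 * u, 0⟩ := by decide +kernel
  have h₂ : ∀ u : Fin 4 → ℤˣ, ∃ i, vertex i = fun c => ⟨u c, 0⟩ := by decide +kernel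
  have h₃ : ∀ σ : Equiv.Perm (Fin 4), σ.sign = 1 → ∀ u₁ u₂ u₃ : ℤˣ,
      ∃ i, vertex i = ![⟨0, u₁⟩, ⟨u₂, 0⟩, ⟨-u₃, u₃⟩, 0] ∘ σ := by decide +kernel
  obtain ⟨u, c, rfl⟩ | ⟨u, rfl⟩ | ⟨σ, hσ, u₁, u₂, u₃, rfl⟩ := hv
  exacts [h₁ u c, h₂ u, h₃ σ hσ u₁ u₂ u₃]

theorem isSign_iff {x : ℝ} : IsSign x ↔ ∃ u : ℤˣ, x = (u : ℤ) := by
  constructor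
  · rintro (rfl | rfl)
    exacts [⟨1, by simp⟩, ⟨-1, by simp⟩]
  · rintro ⟨u, rfl⟩
    obtain rfl | rfl := Int.units_eq_one_or u <;> simp [IsSign]

theorem mem_V600_iff {q : Quaternion ℝ} :
    q ∈ V600 ↔ ∃ v, IsModelVertex v ∧ toQuaternion v = q := by
  have hinv : gr⁻¹ = gr - 1 :=
    inv_eq_of_mul_eq_one_right (by linear_combination gr_sq)
  have hsingle (x : ℝ) (w : Fin 4 → ℝ) : (w = ![x, 0, 0, 0] ∨ w = ![0, x, 0, 0] ∨
      w = ![0, 0, x, 0] ∨ w = ![0, 0, 0, x]) ↔ ∃ c, w = Pi.single c x := by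
    have h (c : Fin 4) : Pi.single c x =
        ![![x, 0, 0, 0], ![0, x, 0, 0], ![0, 0, x, 0], ![0, 0, 0, x]] c := by
      ext d
      fin_cases c <;> fin_cases d <;> simp
    simp [h, Fin.exists_fin_succ]
  have hcoords₁ (u : ℤˣ) (c : Fin 4) :
      (fun d => GoldenInt.toReal ((Pi.single c ⟨2 * u, 0⟩ : Fin 4 → GoldenInt) d) / 2) =
        Pi.single c ((u : ℤ) : ℝ) := by
    ext d
    by_cases hd : d = c
    · subst hd
      simp [GoldenInt.toReal_apply]
    · simp [hd]
  have hcoords₂ (σ : Equiv.Perm (Fin 4)) (u₁ u₂ u₃ : ℤˣ) :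
      (fun c => GoldenInt.toReal ((![⟨0, u₁⟩, ⟨u₂, 0⟩, ⟨-u₃, u₃⟩, 0] ∘ σ) c) / 2) =
        ![(u₁ : ℤ) * gr / 2, (u₂ : ℤ) / 2, (u₃ : ℤ) / (2 * gr), 0] ∘ σ := by
    ext c
    simp only [Function.comp_apply]
    generalize σ c = d
    fin_cases d <;> simp [GoldenInt.toReal_apply, div_eq_mul_inv, hinv]
    ring
  constructor
  · rintro (⟨ε, hε, h⟩ | ⟨ε₀, ε₁, ε₂, ε₃, h₀, h₁, h₂, h₃, h⟩ | ⟨ε₁, ε₂, ε₃, h₁, h₂, h₃, σ, hσ, h⟩)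
    · obtain ⟨u, rfl⟩ := isSign_iff.1 hε
      obtain ⟨c, hc⟩ := (hsingle _ _).1 h
      refine ⟨_, .inl ⟨u, c, rfl⟩, coords_injective ?_⟩
      rw [hc, coords_toQuaternion, hcoords₁]
    · rw [isSign_iff] at h₀ h₁ h₂ h₃
      obtain ⟨u₀, rfl⟩ := h₀
      obtain ⟨u₁, rfl⟩ := h₁
      obtain ⟨u₂, rfl⟩ := h₂
      obtain ⟨u₃, rfl⟩ := h₃
      refine ⟨_, .inr (.inl ⟨![u₀, u₁, u₂, u₃], rfl⟩), coords_injective ?_⟩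
      rw [h, coords_toQuaternion]
      ext c
      fin_cases c <;> simp [GoldenInt.toReal_apply]
    · rw [isSign_iff] at h₁ h₂ h₃
      obtain ⟨u₁, rfl⟩ := h₁
      obtain ⟨u₂, rfl⟩ := h₂
      obtain ⟨u₃, rfl⟩ := h₃
      refine ⟨_, .inr (.inr ⟨σ, hσ, u₁, u₂, u₃, rfl⟩), coords_injective ?_⟩
      rw [h, coords_toQuaternion, hcoords₂]
  · rintro ⟨v, ⟨u, c, rfl⟩ | ⟨u, rfl⟩ | ⟨σ, hσ, u₁, u₂, u₃, rfl⟩, rfl⟩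
    · refine .inl ⟨(u : ℤ), isSign_iff.2 ⟨u, rfl⟩, ?_⟩
      exact (hsingle _ _).2 ⟨c, by rw [coords_toQuaternion, hcoords₁]⟩
    · refine .inr (.inl ⟨_, _, _, _, isSign_iff.2 ⟨u 0, rfl⟩, isSign_iff.2 ⟨u 1, rfl⟩,
        isSign_iff.2 ⟨u 2, rfl⟩, isSign_iff.2 ⟨u 3, rfl⟩, ?_⟩)
      rw [coords_toQuaternion]
      ext c
      fin_cases c <;> simp [GoldenInt.toReal_apply]
    · refine .inr (.inr ⟨_, _, _, isSign_iff.2 ⟨u₁, rfl⟩, isSign_iff.2 ⟨u₂, rfl⟩,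
        isSign_iff.2 ⟨u₃, rfl⟩, σ, hσ, ?_⟩)
      rw [coords_toQuaternion, hcoords₂]

/-- The vertices of the 600-cell are indexed by `Fin 120`. -/
noncomputable def vertexEquiv : Fin 120 ≃ V600 :=
  Equiv.ofBijective (fun i => ⟨toQuaternion (vertex i),
      mem_V600_iff.2 ⟨vertex i, isModelVertex_vertex i, rfl⟩⟩)
    ⟨fun _ _ h => vertex_injective (toQuaternion_injective (congrArg Subtype.val h)), by
      rintro ⟨q, hq⟩
      obtain ⟨v, hv, rfl⟩ := mem_V600_iff.1 hq
      obtain ⟨i, rfl⟩ := hv.exists_vertex_eq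
      exact ⟨i, rfl⟩⟩

theorem sigma600_adj_vertexEquiv (i j : Fin 120) :
    sigma600.Adj (vertexEquiv i) (vertexEquiv j) ↔ modelGraph.Adj i j := by
  have h (i j : Fin 120) :
      ‖(vertexEquiv i : Quaternion ℝ) - (vertexEquiv j : Quaternion ℝ)‖ = gr - 1 ↔
        modelGraph.Adj i j := norm_toQuaternion_sub_eq_iff _ _
  rw [sigma600, SimpleGraph.fromRel_adj, h, h, vertexEquiv.injective.ne_iff,
    modelGraph.adj_comm j i, or_self, and_iff_right_iff_imp]
  exact SimpleGraph.Adj.ne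

/-- The palette prescribing the colors of the first four vertices. -/
def cliquePalette (i : Fin 120) : List (Fin 5) :=
  if i.1 < 4 then [Fin.ofNat 5 i.1] else [0, 1, 2, 3, 4]

set_option maxRecDepth 10000 in
theorem card_listColorings_modelGraph :
    (listColorings modelGraph cliquePalette (List.finRange 120).reverse).toFinset.card = 10 := by
  decide +kernel

theorem forall_mem_cliquePalette_iff {f : Fin 120 → Fin 5} :
    (∀ i, f i ∈ cliquePalette i) ↔
      ∀ i : Fin 4, f (i.castLE (by norm_num)) = i.castSucc := by
  constructor
  · intro h i
    have := h (i.castLE (by norm_num))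
    rw [cliquePalette, if_pos (by simp), List.mem_singleton] at this
    refine this.trans (Fin.ext ?_)
    simp
  · intro h i
    by_cases hi : i.1 < 4
    · have := h ⟨i, hi⟩
      rw [cliquePalette, if_pos hi, List.mem_singleton]
      refine this.trans (Fin.ext ?_)
      simp
      omega
    · rw [cliquePalette, if_neg hi]
      generalize f i = c
      decide +revert

theorem card_colorings_modelGraph :
    Nat.card {f : Fin 120 → Fin 5 // ∀ i j, modelGraph.Adj i j → f i ≠ f j} = 1200 := by
  have hclique : ∀ i j : Fin 4, i ≠ j →
      modelGraph.Adj (i.castLE (by norm_num)) (j.castLE (by norm_num)) := by decide +kernel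
  rw [card_colorings_eq_factorial_mul modelGraph _ hclique]
  simp_rw [← forall_mem_cliquePalette_iff]
  rw [card_listColorings (l := (List.finRange 120).reverse)
    (List.nodup_reverse.2 (List.nodup_finRange 120)) (by simp), card_listColorings_modelGraph]
  rfl

end SixHundredCell

/-- The 600-cell graph has exactly 1200 proper colorings with 5 colors. -/
theorem card_six_hundred_cell_five_colorings :
    Nat.card {f : V600 → Fin 5 // ∀ q q' : V600, sigma600.Adj q q' → f q ≠ f q'}
      = 1200 := by
  rw [← SixHundredCell.card_colorings_modelGraph]
  refine Nat.card_congr ((SixHundredCell.vertexEquiv.symm.arrowCongr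
    (Equiv.refl _)).subtypeEquiv fun f => ?_)
  simp only [← SixHundredCell.sigma600_adj_vertexEquiv]
  rw [← SixHundredCell.vertexEquiv.forall_congr_right]
  exact forall_congr' fun i => SixHundredCell.vertexEquiv.forall_congr_right.symm
end
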